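/- Let n ≥ 1, y ∈ ℝⁿ, H an n×2 real matrix, and V₀ a positive definite 2×2 real matrix. Define V := (V₀⁻¹ + HᵀH)⁻¹ and w := V Hᵀ y. Then ‖y‖² − wᵀ V⁻¹ w = inf_{β ∈ ℝ²} ( ‖y − Hβ‖² + βᵀ V₀⁻¹ β ), and in particular ‖y‖² − wᵀ V⁻¹ w ≥ 0. (Consequently the updated scale parameter b_{s,t} = b + (‖y‖² − wᵀ V⁻¹ w)/2 of the posterior Inverse-Gamma distribution satisfies b_{s,t} ≥ b > 0.) -/

import Mathlib

open Matrix

theorem ridge_complete_square {m k : Type*} [Fintype m] [Fintype k] (y : m → ℝ)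
    (H : Matrix m k ℝ) (P : Matrix k k ℝ) (hP : Pᵀ = P) (w : k → ℝ)
    (hw : (P + Hᵀ * H) *ᵥ w = Hᵀ *ᵥ y) (β : k → ℝ) :
    (∑ i, (y i - (H *ᵥ β) i) ^ 2) + β ⬝ᵥ P *ᵥ β =
      (∑ i, y i ^ 2) - w ⬝ᵥ (P + Hᵀ * H) *ᵥ w +
        (β - w) ⬝ᵥ (P + Hᵀ * H) *ᵥ (β - w) := by
  have hsymm : w ⬝ᵥ (P + Hᵀ * H) *ᵥ β = β ⬝ᵥ (P + Hᵀ * H) *ᵥ w := by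
    have hA : (P + Hᵀ * H)ᵀ = P + Hᵀ * H := by simp [hP]
    rw [dotProduct_mulVec, ← mulVec_transpose, hA, dotProduct_comm]
  have hcross : y ⬝ᵥ H *ᵥ β = β ⬝ᵥ (P + Hᵀ * H) *ᵥ w := by
    rw [hw, dotProduct_mulVec, ← mulVec_transpose, dotProduct_comm]
  have hgram : β ⬝ᵥ (P + Hᵀ * H) *ᵥ β = β ⬝ᵥ P *ᵥ β + (H *ᵥ β) ⬝ᵥ (H *ᵥ β) := by
    rw [add_mulVec, dotProduct_add, ← mulVec_mulVec, dotProduct_mulVec β Hᵀ, vecMul_transpose]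
  have hsq : ∑ i, (y i - (H *ᵥ β) i) ^ 2 =
      (∑ i, y i ^ 2) - 2 * (y ⬝ᵥ H *ᵥ β) + (H *ᵥ β) ⬝ᵥ (H *ᵥ β) := by
    simp only [dotProduct, Finset.mul_sum, ← Finset.sum_sub_distrib, ← Finset.sum_add_distrib]
    exact Finset.sum_congr rfl fun i _ => by ring
  rw [hsq, mulVec_sub, dotProduct_sub, sub_dotProduct, sub_dotProduct, hsymm, hcross, hgram]
  ring

/-- With `V := (V₀⁻¹ + HᵀH)⁻¹` and `w := V Hᵀ y`:
`‖y‖² − wᵀV⁻¹w = inf_β (‖y − Hβ‖² + βᵀV₀⁻¹β)`, in particular it is nonnegative,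
and consequently the updated scale `b + (‖y‖² − wᵀV⁻¹w)/2` is at least `b > 0`. -/
theorem stmt_7 (n : ℕ) (hn : 1 ≤ n) (y : Fin n → ℝ) (H : Matrix (Fin n) (Fin 2) ℝ)
    (V0 : Matrix (Fin 2) (Fin 2) ℝ) (hV0 : V0.PosDef)
    (V : Matrix (Fin 2) (Fin 2) ℝ) (hV : V = (V0⁻¹ + Hᵀ * H)⁻¹)
    (w : Fin 2 → ℝ) (hw : w = V.mulVec (Hᵀ.mulVec y)) :
    ((∑ i, y i ^ 2) - w ⬝ᵥ (V⁻¹).mulVec w =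
        ⨅ β : Fin 2 → ℝ, ((∑ i, (y i - H.mulVec β i) ^ 2) + β ⬝ᵥ (V0⁻¹).mulVec β)) ∧
    0 ≤ (∑ i, y i ^ 2) - w ⬝ᵥ (V⁻¹).mulVec w ∧
    ∀ b : ℝ, 0 < b →
      b ≤ b + ((∑ i, y i ^ 2) - w ⬝ᵥ (V⁻¹).mulVec w) / 2 ∧
      0 < b + ((∑ i, y i ^ 2) - w ⬝ᵥ (V⁻¹).mulVec w) / 2 := by
  have hP : V0⁻¹.PosDef := hV0.inv
  have hA : (V0⁻¹ + Hᵀ * H).PosDef :=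
    hP.add_posSemidef (by simpa using posSemidef_conjTranspose_mul_self H)
  have hdet : IsUnit (V0⁻¹ + Hᵀ * H).det := (isUnit_iff_isUnit_det _).mp hA.isUnit
  have hVinv : V⁻¹ = V0⁻¹ + Hᵀ * H := by rw [hV, nonsing_inv_nonsing_inv _ hdet]
  have hAw : (V0⁻¹ + Hᵀ * H) *ᵥ w = Hᵀ *ᵥ y := by
    rw [hw, hV, mulVec_mulVec, mul_nonsing_inv _ hdet, one_mulVec]
  have hsq := ridge_complete_square y H V0⁻¹ (by simpa using hP.isHermitian.eq) w hAw
  rw [hVinv]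
  have hnonneg : 0 ≤ (∑ i, y i ^ 2) - w ⬝ᵥ (V0⁻¹ + Hᵀ * H) *ᵥ w := by
    have h := hsq w
    rw [sub_self, zero_dotProduct, add_zero] at h
    rw [← h]
    exact add_nonneg (Finset.sum_nonneg fun i _ => sq_nonneg _)
      (by simpa using hP.posSemidef.dotProduct_mulVec_nonneg w)
  refine ⟨?_, hnonneg, fun b hb => ⟨by linarith, by linarith⟩⟩
  symm
  refine IsLeast.csInf_eq ⟨⟨w, by simp only [hsq w, sub_self, zero_dotProduct, add_zero]⟩, ?_⟩
  rintro _ ⟨β, rfl⟩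
  have h : 0 ≤ (β - w) ⬝ᵥ (V0⁻¹ + Hᵀ * H) *ᵥ (β - w) := by
    simpa using hA.posSemidef.dotProduct_mulVec_nonneg (β - w)
  simp only [hsq β]
  linarith
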